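/- Let H be a real Hilbert space, D ⊆ H a nonempty closed convex set, T : H → H nonexpansive with T(D) ⊆ D and Fix T nonempty, y ∈ D, x₀ ∈ D, and let λ : [0, ∞) → (0, 1] and ε : [0, ∞) → (0, ∞) be Lebesgue measurable with ε locally integrable. Let x be the strong global solution of ẋ(t) = λ(t)·(T(x(t)) − x(t)) − ε(t)·(x(t) − y), x(0) = x₀. Assume: (i) ∫₀^∞ ε(t) dt = ∞; (ii) ∫₀^∞ λ(t) dt = ∞; (iii) ε and λ are locally absolutely continuous, t ↦ ε(t)/λ(t) is nonincreasing and ε(t)/λ(t) → 0 as t → ∞; (iv) ε̇(t)/ε(t)² − λ̇(t)/(λ(t)·ε(t)) → 0 as t → ∞. Then x(t) converges strongly, as t → ∞, to P_{Fix T} y. -/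

import Mathlib

open Filter MeasureTheory Set Topology
open scoped RealInnerProductSpace

variable {H : Type*} [NormedAddCommGroup H] [InnerProductSpace ℝ H] [CompleteSpace H]

/-- `x` is a strong global solution of `ẋ(t) = f(t, x(t))`, `x(0) = x₀`, on `[0,∞)`. -/
def IsStrongGlobalSolution (f : ℝ → H → H) (x₀ : H) (x : ℝ → H) : Prop :=
  ContinuousOn x (Set.Ici (0 : ℝ)) ∧
  (∀ b : ℝ, IntervalIntegrable (fun s => f s (x s)) volume 0 b) ∧
  ∀ t : ℝ, 0 ≤ t → x t = x₀ + ∫ s in (0:ℝ)..t, f s (x s)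

lemma aux_hasDeriv {E : Type*} [NormedAddCommGroup E] [NormedSpace ℝ E] [CompleteSpace E]
    (g : ℝ → E) (hg : ContinuousOn g (Ici (0:ℝ))) {t : ℝ} (ht : 0 < t) :
    HasDerivAt (fun t => ∫ s in (0:ℝ)..t, g s) (g t) t := by
  apply intervalIntegral.integral_hasDerivAt_right
  · apply ContinuousOn.intervalIntegrable
    apply hg.mono
    rw [uIcc_of_le ht.le]
    exact Icc_subset_Ici_self
  · exact (hg.mono Ioi_subset_Ici_self).stronglyMeasurableAtFilter isOpen_Ioi t ht
  · exact hg.continuousAt (Ici_mem_nhds ht)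

lemma aux_comp_ac {f h : ℝ → ℝ} {a b K : ℝ} (hK : 0 < K)
    (hf : AbsolutelyContinuousOnInterval f a b)
    (hh : ∀ x ∈ uIcc a b, ∀ y ∈ uIcc a b, dist (h x) (h y) ≤ K * dist (f x) (f y)) :
    AbsolutelyContinuousOnInterval h a b := by
  rw [absolutelyContinuousOnInterval_iff] at hf ⊢
  intro ε hε
  obtain ⟨δ, hδ, H⟩ := hf (ε / K) (by positivity)
  refine ⟨δ, hδ, fun E hE hlt => ?_⟩
  have h1 := H E hE hlt
  calc _ ≤ ∑ i ∈ Finset.range E.1, K * dist (f (E.2 i).1) (f (E.2 i).2) := by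
        apply Finset.sum_le_sum
        intro i hi
        have := hE.1 i hi
        exact hh _ this.1 _ this.2
    _ < ε := by
        rw [← Finset.mul_sum]
        rw [lt_div_iff₀ hK] at h1
        linarith

lemma aux_log_ac {f : ℝ → ℝ} {a b : ℝ} (hf : AbsolutelyContinuousOnInterval f a b)
    (hpos : ∀ x ∈ uIcc a b, 0 < f x) :
    AbsolutelyContinuousOnInterval (fun x => Real.log (f x)) a b := by
  obtain ⟨x₀, hx₀, hmin⟩ := isCompact_uIcc.exists_isMinOn nonempty_uIcc hf.continuousOn
  have hm := hpos x₀ hx₀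
  have key : ∀ x ∈ uIcc a b, ∀ y ∈ uIcc a b,
      Real.log (f x) - Real.log (f y) ≤ (f x₀)⁻¹ * |f x - f y| := by
    intro x hx y hy
    have hfx := hpos x hx
    have hfy := hpos y hy
    rw [← Real.log_div hfx.ne' hfy.ne']
    have h1 := Real.log_le_sub_one_of_pos (div_pos hfx hfy)
    have h2 : f x / f y - 1 = (f y)⁻¹ * (f x - f y) := by field_simp
    have h3 : (f y)⁻¹ ≤ (f x₀)⁻¹ := inv_anti₀ hm (hmin hy)
    calc _ ≤ _ := h1
      _ = _ := h2
      _ ≤ (f y)⁻¹ * |f x - f y| := by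
        apply mul_le_mul_of_nonneg_left (le_abs_self _) (by positivity)
      _ ≤ _ := by gcongr
  refine aux_comp_ac (inv_pos.2 hm) hf fun x hx y hy => ?_
  rw [Real.dist_eq, Real.dist_eq, abs_le]
  refine ⟨?_, key x hx y hy⟩
  have := key y hy x hx
  rw [abs_sub_comm] at this
  linarith

lemma aux_ac {f f' : ℝ → ℝ} (hint : ∀ b : ℝ, IntervalIntegrable f' volume 0 b)
    (hf : ∀ t : ℝ, 0 ≤ t → f t = f 0 + ∫ s in (0:ℝ)..t, f' s) {t : ℝ} (ht : 0 ≤ t) :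
    AbsolutelyContinuousOnInterval f 0 t := by
  refine aux_comp_ac one_pos ((hint t).absolutelyContinuousOnInterval_intervalIntegral (c := 0)
    left_mem_uIcc) ?_
  intro x hx y hy
  rw [uIcc_of_le ht] at hx hy
  rw [hf x hx.1, hf y hy.1]
  simp

lemma aux_ae {f f' : ℝ → ℝ} (hint : ∀ b : ℝ, IntervalIntegrable f' volume 0 b)
    (hf : ∀ t : ℝ, 0 ≤ t → f t = f 0 + ∫ s in (0:ℝ)..t, f' s) {t : ℝ} (ht : 0 ≤ t) :
    ∀ᵐ x, x ∈ Ioc 0 t → HasDerivAt f (f' x) x := by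
  filter_upwards [(hint t).ae_hasDerivAt_integral] with x hx hx'
  have h1 := hx (by rw [uIcc_of_le ht]; exact Ioc_subset_Icc_self hx') 0 left_mem_uIcc
  have h2 := h1.const_add (f 0)
  refine h2.congr_of_eventuallyEq ?_
  filter_upwards [Ioi_mem_nhds hx'.1] with w hw
  exact hf w (le_of_lt hw)

lemma aux_logratio (lam eps epsd lamd : ℝ → ℝ)
    (hlam : ∀ t : ℝ, 0 ≤ t → 0 < lam t) (heps : ∀ t : ℝ, 0 ≤ t → 0 < eps t)
    (hepsd_int : ∀ b : ℝ, IntervalIntegrable epsd volume 0 b)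
    (hepsAC : ∀ t : ℝ, 0 ≤ t → eps t = eps 0 + ∫ s in (0:ℝ)..t, epsd s)
    (hlamd_int : ∀ b : ℝ, IntervalIntegrable lamd volume 0 b)
    (hlamAC : ∀ t : ℝ, 0 ≤ t → lam t = lam 0 + ∫ s in (0:ℝ)..t, lamd s)
    (heps_int : ∀ b : ℝ, IntervalIntegrable eps volume 0 b)
    {S η : ℝ} (hS : 0 ≤ S)
    (hq : ∀ t, S ≤ t → |epsd t / (eps t) ^ 2 - lamd t / (lam t * eps t)| ≤ η)
    {s t : ℝ} (hs : S ≤ s) (hst : s ≤ t) :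
    |Real.log (eps t / lam t) - Real.log (eps s / lam s)| ≤ η * ∫ w in s..t, eps w := by
  have hs0 : 0 ≤ s := hS.trans hs
  have ht0 : 0 ≤ t := hs0.trans hst
  have hsub : uIcc s t ⊆ uIcc 0 t := by
    rw [uIcc_of_le hst, uIcc_of_le ht0]; exact Icc_subset_Icc_left hs0
  have hmem : ∀ w ∈ uIcc s t, 0 ≤ w := by
    intro w hw
    rw [uIcc_of_le hst] at hw
    exact hs0.trans hw.1
  have A1 := aux_log_ac ((aux_ac hepsd_int hepsAC ht0).mono hsub) fun w hw => heps w (hmem w hw)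
  have A2 := aux_log_ac ((aux_ac hlamd_int hlamAC ht0).mono hsub) fun w hw => hlam w (hmem w hw)
  have A := A1.fun_sub A2
  have hint : IntervalIntegrable eps volume s t := (heps_int s).symm.trans (heps_int t)
  have h := A.integral_deriv_eq_sub
  rw [Real.log_div (heps t ht0).ne' (hlam t ht0).ne',
    Real.log_div (heps s hs0).ne' (hlam s hs0).ne', ← h, ← intervalIntegral.integral_const_mul,
    ← Real.norm_eq_abs]
  apply intervalIntegral.norm_integral_le_of_norm_le hst _ (hint.const_mul η)
  filter_upwards [aux_ae hepsd_int hepsAC ht0, aux_ae hlamd_int hlamAC ht0] with w h1 h2 hw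
  have hw0 : 0 ≤ w := hs0.trans hw.1.le
  have hw' : w ∈ Ioc 0 t := ⟨hs0.trans_lt hw.1, hw.2⟩
  have d := ((h1 hw').log (heps w hw0).ne').sub ((h2 hw').log (hlam w hw0).ne')
  have d' : HasDerivAt (fun x => Real.log (eps x) - Real.log (lam x)) _ w := d
  rw [d'.deriv, Real.norm_eq_abs]
  have he := heps w hw0
  have hl := hlam w hw0
  have : epsd w / eps w - lamd w / lam w
      = (epsd w / (eps w) ^ 2 - lamd w / (lam w * eps w)) * eps w := by
    field_simp
  rw [this, abs_mul, abs_of_pos he]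
  exact mul_le_mul_of_nonneg_right (hq w (hs.trans hw.1.le)) he.le

lemma aux_fence (e u E : ℝ → ℝ) (S c : ℝ) (hc : 0 < c) (hE : ∀ t, S ≤ t → HasDerivAt E (e t) t)
    (he : ∀ t, S ≤ t → 0 < e t) (hu : ContinuousOn u (Ici S))
    (hsl : ∀ t, S ≤ t → ∀ r, -e t * u t + c * e t < r → ∃ᶠ z in 𝓝[>] t, slope u t z < r) :
    ∀ t, S ≤ t → u t ≤ 2 * c + u S * Real.exp (-(E t - E S)) := by
  intro t ht
  have hB : ∀ x, S ≤ x → HasDerivAt (fun x => 2 * c + u S * Real.exp (-(E x - E S)))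
      (u S * (Real.exp (-(E x - E S)) * -(e x))) x := by
    intro x hx
    exact ((((hE x hx).sub_const (E S)).fun_neg.exp).const_mul (u S)).const_add (2 * c)
  refine image_le_of_liminf_slope_right_lt_deriv_boundary' (a := S) (b := t) (f := u)
    (f' := fun x => -e x * u x + c * e x)
    (B := fun x => 2 * c + u S * Real.exp (-(E x - E S)))
    (B' := fun x => u S * (Real.exp (-(E x - E S)) * -(e x)))
    (hu.mono Icc_subset_Ici_self) (fun x hx => hsl x hx.1) ?_ ?_ ?_ ?_ ⟨ht, le_rfl⟩
  · simp; linarith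
  · exact fun x hx => (hB x hx.1).continuousAt.continuousWithinAt
  · exact fun x hx => (hB x hx.1).hasDerivWithinAt
  · intro x hx hux
    have := mul_pos hc (he x hx.1)
    rw [hux]
    linarith

lemma aux_lip (T : H → H) (hT : ∀ x y : H, ‖T x - T y‖ ≤ ‖x - y‖) (y : H) {r s : ℝ}
    (hr : 0 < r) (hrs : r ≤ s) {a b : H} (ha : T a - a = r • (a - y)) (hb : T b - b = s • (b - y)) :
    ‖a - b‖ ≤ ‖a - y‖ * |Real.log r - Real.log s| := by
  have hs : 0 < s := hr.trans_le hrs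
  have h1 : (1 + s) • (a - b) = (T a - T b) + (s - r) • (a - y) := by
    have ha' : T a = a + r • (a - y) := by rw [← ha]; abel
    have hb' : T b = b + s • (b - y) := by rw [← hb]; abel
    rw [ha', hb']
    module
  have h2 : (1 + s) * ‖a - b‖ ≤ ‖a - b‖ + (s - r) * ‖a - y‖ := by
    have h3 : ‖(1 + s) • (a - b)‖ = (1 + s) * ‖a - b‖ := by
      rw [norm_smul, Real.norm_eq_abs, abs_of_pos (by linarith)]
    rw [← h3, h1]
    refine (norm_add_le _ _).trans ?_
    rw [norm_smul, Real.norm_eq_abs, abs_of_nonneg (by linarith)]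
    linarith [hT a b]
  have h4 : s - r ≤ s * |Real.log r - Real.log s| := by
    have := Real.log_le_sub_one_of_pos (div_pos hr hs)
    rw [Real.log_div hr.ne' hs.ne'] at this
    have h5 : 1 - r / s ≤ |Real.log r - Real.log s| := by
      linarith [neg_abs_le (Real.log r - Real.log s)]
    calc s - r = s * (1 - r / s) := by field_simp
      _ ≤ _ := by gcongr
  have h6 := mul_le_mul_of_nonneg_right h4 (norm_nonneg (a - y))
  have h7 : s * ‖a - b‖ ≤ s * (‖a - y‖ * |Real.log r - Real.log s|) := by nlinarith
  exact le_of_mul_le_mul_left h7 hs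

lemma aux_mono (T : H → H) (hT : ∀ x y : H, ‖T x - T y‖ ≤ ‖x - y‖) (y : H) {r s : ℝ}
    (hr : 0 ≤ r) (hs : 0 < s) (hrs : r ≤ s) {a b : H} (ha : T a - a = r • (a - y))
    (hb : T b - b = s • (b - y)) :
    ‖a - b‖ ^ 2 ≤ ‖a - y‖ ^ 2 - ‖b - y‖ ^ 2 := by
  have ha' : T a = a + r • (a - y) := by rw [← ha]; abel
  have hb' : T b = b + s • (b - y) := by rw [← hb]; abel
  have h0 : ⟪T a - T b, a - b⟫ ≤ ‖a - b‖ ^ 2 := by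
    refine (real_inner_le_norm _ _).trans ?_
    nlinarith [hT a b, norm_nonneg (a - b)]
  have h1 : T a - T b = (a - b) + (r • (a - y) - s • (b - y)) := by rw [ha', hb']; abel
  rw [h1, inner_add_left, real_inner_self_eq_norm_sq] at h0
  have hab : a - b = (a - y) - (b - y) := by abel
  rw [hab] at h0 ⊢
  generalize a - y = p at h0 ⊢
  generalize b - y = q at h0 ⊢
  rw [inner_sub_left, real_inner_smul_left, real_inner_smul_left, inner_sub_right, inner_sub_right,
    real_inner_self_eq_norm_sq, real_inner_self_eq_norm_sq, real_inner_comm p q] at h0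
  have h2 := norm_sub_sq_real p q
  have h2' : 2 * ⟪p, q⟫ = ‖p‖ ^ 2 + ‖q‖ ^ 2 - ‖p - q‖ ^ 2 := by linarith
  have hrc : ⟪q, p⟫ = ⟪p, q⟫ := real_inner_comm _ _
  try rw [hrc] at h0
  have h3 : (r + s) * ‖p - q‖ ^ 2 ≤ (s - r) * (‖p‖ ^ 2 - ‖q‖ ^ 2) := by nlinarith
  have h4 : 0 ≤ ‖p‖ ^ 2 - ‖q‖ ^ 2 := by
    rcases hrs.eq_or_lt with h | h
    · subst h
      have : ‖p - q‖ ^ 2 ≤ 0 := by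
        have : 0 < r + r := by linarith
        nlinarith [sq_nonneg ‖p - q‖]
      have h5 : p - q = 0 := by
        have := le_antisymm this (sq_nonneg _)
        simpa using this
      rw [sub_eq_zero] at h5
      rw [h5]; simp
    · have : 0 ≤ (r + s) * ‖p - q‖ ^ 2 := by positivity
      by_contra hneg
      push Not at hneg
      nlinarith
  have h5 : (s - r) * (‖p‖ ^ 2 - ‖q‖ ^ 2) ≤ (r + s) * (‖p‖ ^ 2 - ‖q‖ ^ 2) := by
    apply mul_le_mul_of_nonneg_right _ h4
    linarith
  exact le_of_mul_le_mul_left (h3.trans h5) (by linarith)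

lemma aux_exists (T : H → H) (hT : ∀ x y : H, ‖T x - T y‖ ≤ ‖x - y‖) (y : H) {r : ℝ}
    (hr : 0 < r) : ∃ z : H, T z - z = r • (z - y) := by
  obtain ⟨K, hK⟩ : ∃ K : NNReal, (K : ℝ) = (1 + r)⁻¹ :=
    ⟨Real.toNNReal _, Real.coe_toNNReal _ (by positivity)⟩
  have hc : ContractingWith K
      (fun w => (1 + r)⁻¹ • (T w + r • y)) := by
    constructor
    · rw [← NNReal.coe_lt_coe, hK]
      exact inv_lt_one_of_one_lt₀ (by linarith)
    · apply LipschitzWith.of_dist_le_mul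
      intro a b
      rw [hK, dist_eq_norm, dist_eq_norm, ← smul_sub, norm_smul, Real.norm_eq_abs,
        abs_of_pos (by positivity)]
      simp only [add_sub_add_right_eq_sub]
      exact mul_le_mul_of_nonneg_left (hT a b) (by positivity)
  refine ⟨hc.fixedPoint, ?_⟩
  have h := hc.fixedPoint_isFixedPt
  have h' : (1 + r)⁻¹ • (T hc.fixedPoint + r • y) = hc.fixedPoint := h
  generalize hc.fixedPoint = z at h'
  have h2 : T z + r • y = (1 + r) • z := by
    rw [inv_smul_eq_iff₀ (by positivity)] at h'
    exact h'
  have h3 : T z = (1 + r) • z - r • y := by rw [← h2]; abel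
  rw [h3]; module

lemma aux_slope (T : H → H) (hT : ∀ x y : H, ‖T x - T y‖ ≤ ‖x - y‖) (y : H)
    (x z : ℝ → H) (E : ℝ → ℝ) (l e c t : ℝ) (hl : 0 < l) (he : 0 < e) (hc : 0 < c)
    (hx : HasDerivAt x (l • (T (x t) - x t) - e • (x t - y)) t)
    (hE : HasDerivAt E e t)
    (hz : T (z t) - z t = (e / l) • (z t - y))
    (hzz : ∀ w, t ≤ w → ‖z w - z t‖ ≤ c * (E w - E t)) :
    ∀ r, -e * ‖x t - z t‖ + c * e < r →
      ∃ᶠ w in 𝓝[>] t, slope (fun w => ‖x w - z w‖) t w < r := by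
  intro r hr
  apply Eventually.frequently
  obtain ⟨κ, hκ, hκr⟩ : ∃ κ > 0, κ + (-e * ‖x t - z t‖) + c * (e + κ) < r := by
    refine ⟨(r - (-e * ‖x t - z t‖ + c * e)) / (2 * (1 + c)), by
      apply div_pos <;> linarith, ?_⟩
    have : (r - (-e * ‖x t - z t‖ + c * e)) / (2 * (1 + c)) * (1 + c)
        = (r - (-e * ‖x t - z t‖ + c * e)) / 2 := by field_simp
    nlinarith
  have e1 := (hasDerivAt_iff_isLittleO.1 hx).def hκ
  have e2 := (hasDerivAt_iff_isLittleO.1 hE).def hκ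
  have e3 : ∀ᶠ w in 𝓝 t, w < t + (l + e)⁻¹ := Iio_mem_nhds (by
    have : 0 < (l + e)⁻¹ := by positivity
    linarith)
  filter_upwards [e1.filter_mono nhdsWithin_le_nhds, e2.filter_mono nhdsWithin_le_nhds,
    e3.filter_mono nhdsWithin_le_nhds, self_mem_nhdsWithin] with w h1 h2 h3 h4
  have h4' : t < w := h4
  have hh : 0 < w - t := sub_pos.2 h4'
  rw [Real.norm_eq_abs (w - t), abs_of_pos hh] at h1 h2
  rw [Real.norm_eq_abs, smul_eq_mul] at h2
  have h2' : E w - E t ≤ (e + κ) * (w - t) := by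
    linarith [le_abs_self (E w - E t - (w - t) * e)]
  have h3' : (w - t) * (l + e) ≤ 1 := by
    have : w - t ≤ (l + e)⁻¹ := by linarith
    calc _ ≤ (l + e)⁻¹ * (l + e) := by gcongr
      _ = 1 := by field_simp
  have h5 : ‖x t + (w - t) • (l • (T (x t) - x t) - e • (x t - y)) - z t‖
      ≤ (1 - (w - t) * e) * ‖x t - z t‖ := by
    have hz' : l • (T (z t) - z t) - e • (z t - y) = 0 := by
      rw [hz, smul_smul, mul_div_cancel₀ _ hl.ne', sub_self]
    have : x t + (w - t) • (l • (T (x t) - x t) - e • (x t - y)) - z t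
        = (1 - (w - t) * (l + e)) • (x t - z t) + ((w - t) * l) • (T (x t) - T (z t)) := by
      have : x t + (w - t) • (l • (T (x t) - x t) - e • (x t - y)) - z t
        = x t + (w - t) • (l • (T (x t) - x t) - e • (x t - y)
          - (l • (T (z t) - z t) - e • (z t - y))) - z t := by rw [hz', sub_zero]
      rw [this]; module
    rw [this]
    refine (norm_add_le _ _).trans ?_
    rw [norm_smul, norm_smul, Real.norm_eq_abs, Real.norm_eq_abs, abs_of_nonneg (by linarith),
      abs_of_pos (by positivity)]
    have := mul_le_mul_of_nonneg_left (hT (x t) (z t)) (by positivity : 0 ≤ (w - t) * l)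
    linarith
  have h6 := hzz w h4'.le
  have h7 : ‖x w - z w‖ ≤ κ * (w - t) + (1 - (w - t) * e) * ‖x t - z t‖
      + c * ((e + κ) * (w - t)) := by
    have : x w - z w = (x w - x t - (w - t) • (l • (T (x t) - x t) - e • (x t - y)))
      + (x t + (w - t) • (l • (T (x t) - x t) - e • (x t - y)) - z t) - (z w - z t) := by abel
    rw [this]
    refine (norm_sub_le _ _).trans ?_
    have h8 := norm_add_le (x w - x t - (w - t) • (l • (T (x t) - x t) - e • (x t - y)))
      (x t + (w - t) • (l • (T (x t) - x t) - e • (x t - y)) - z t)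
    have h9 := mul_le_mul_of_nonneg_left h2' hc.le
    linarith
  rw [slope_def_field, div_lt_iff₀ hh]
  have := mul_lt_mul_of_pos_right hκr hh
  linarith

lemma aux_cont {f f' : ℝ → ℝ} (hint : ∀ b : ℝ, IntervalIntegrable f' volume 0 b)
    (hf : ∀ t : ℝ, 0 ≤ t → f t = f 0 + ∫ s in (0:ℝ)..t, f' s) : ContinuousOn f (Ici 0) := by
  intro t ht
  have ht' : (0:ℝ) ≤ t := ht
  have h := (aux_ac hint hf (by linarith : (0:ℝ) ≤ t + 1)).continuousOn
  rw [uIcc_of_le (by linarith)] at h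
  refine (h t ⟨ht', by linarith⟩).mono_of_mem_nhdsWithin ?_
  rw [← Ici_inter_Iic]
  exact inter_mem self_mem_nhdsWithin (mem_nhdsWithin_of_mem_nhds (Iic_mem_nhds (by linarith)))

lemma aux_top (e : ℝ → ℝ) (he : ∀ t : ℝ, 0 ≤ t → 0 < e t)
    (hint : ∀ b : ℝ, IntervalIntegrable e volume 0 b)
    (hi : ∫⁻ t in Set.Ioi (0:ℝ), ENNReal.ofReal (e t) = ⊤) :
    Tendsto (fun t => ∫ s in (0:ℝ)..t, e s) atTop atTop := by
  have hmono : ∀ s t, 0 ≤ s → s ≤ t → ∫ w in (0:ℝ)..s, e w ≤ ∫ w in (0:ℝ)..t, e w := by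
    intro s t hs hst
    rw [← sub_nonneg, intervalIntegral.integral_interval_sub_left (hint t) (hint s)]
    exact intervalIntegral.integral_nonneg hst fun w hw => (he w (hs.trans hw.1)).le
  by_cases h : ∃ I, ∀ t, 0 ≤ t → ∫ s in (0:ℝ)..t, e s ≤ I
  · exfalso
    obtain ⟨I, hI⟩ := h
    have : IntegrableOn e (Ioi 0) volume := by
      refine integrableOn_Ioi_of_intervalIntegral_norm_bounded (b := fun t : ℝ => max t 0)
        (l := atTop) I 0 (fun t => ?_) ?_ ?_
      · exact (intervalIntegrable_iff_integrableOn_Ioc_of_le (le_max_right _ _)).1 (hint _)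
      · exact tendsto_atTop_mono (fun t => le_max_left _ _) tendsto_id
      · refine Eventually.of_forall fun t => ?_
        refine le_trans (le_of_eq ?_) (hI (max t 0) (le_max_right _ _))
        refine intervalIntegral.integral_congr fun w hw => ?_
        rw [uIcc_of_le (le_max_right _ _)] at hw
        exact Real.norm_of_nonneg (he w hw.1).le
    have h2 := this.lintegral_lt_top
    rw [hi] at h2
    exact lt_irrefl _ h2
  · push Not at h
    rw [tendsto_atTop]
    intro I
    obtain ⟨t, ht, hI⟩ := h I
    filter_upwards [eventually_ge_atTop t] with w hw
    exact hI.le.trans (hmono t w ht hw)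

theorem stmt7 (D : Set H) (hDne : D.Nonempty) (hDcl : IsClosed D) (hDconv : Convex ℝ D)
    (T : H → H) (hT : ∀ x y : H, ‖T x - T y‖ ≤ ‖x - y‖)
    (hTD : ∀ z ∈ D, T z ∈ D)
    (hFix : ∃ z : H, T z = z)
    (y : H) (hy : y ∈ D) (x₀ : H) (hx₀ : x₀ ∈ D)
    (lam eps : ℝ → ℝ) (hlam_meas : Measurable lam) (heps_meas : Measurable eps)
    (hlam_range : ∀ t : ℝ, 0 ≤ t → lam t ∈ Set.Ioc (0:ℝ) 1)
    (heps_pos : ∀ t : ℝ, 0 ≤ t → 0 < eps t)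
    (heps_int : ∀ b : ℝ, IntervalIntegrable eps volume 0 b)
    (x : ℝ → H)
    (hsol : IsStrongGlobalSolution (fun t w => lam t • (T w - w) - eps t • (w - y)) x₀ x)
    -- (i) ∫₀^∞ ε(t) dt = ∞
    (hi : ∫⁻ t in Set.Ioi (0:ℝ), ENNReal.ofReal (eps t) = ⊤)
    -- (ii) ∫₀^∞ λ(t) dt = ∞
    (hii : ∫⁻ t in Set.Ioi (0:ℝ), ENNReal.ofReal (lam t) = ⊤)
    -- (iii) ε and λ locally absolutely continuous (with derivatives epsd, lamd),
    -- ε/λ nonincreasing and ε(t)/λ(t) → 0 as t → ∞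
    (epsd lamd : ℝ → ℝ)
    (hepsd_int : ∀ b : ℝ, IntervalIntegrable epsd volume 0 b)
    (hepsAC : ∀ t : ℝ, 0 ≤ t → eps t = eps 0 + ∫ s in (0:ℝ)..t, epsd s)
    (hlamd_int : ∀ b : ℝ, IntervalIntegrable lamd volume 0 b)
    (hlamAC : ∀ t : ℝ, 0 ≤ t → lam t = lam 0 + ∫ s in (0:ℝ)..t, lamd s)
    (hmono : ∀ s t : ℝ, 0 ≤ s → s ≤ t → eps t / lam t ≤ eps s / lam s)
    (hratio : Tendsto (fun t => eps t / lam t) atTop (𝓝 (0:ℝ)))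
    -- (iv) ε̇/ε² − λ̇/(λ·ε) → 0 as t → ∞
    (hiv : Tendsto (fun t => epsd t / (eps t) ^ 2 - lamd t / (lam t * eps t))
      atTop (𝓝 (0:ℝ))) :
    ∃ p : H, T p = p ∧ (∀ q : H, T q = q → ‖p - y‖ ≤ ‖q - y‖) ∧
      Tendsto x atTop (𝓝 p) := by
  obtain ⟨hxc, hxint, hxeq⟩ := hsol
  obtain ⟨p0, hp0⟩ := hFix
  have hlp : ∀ t : ℝ, 0 ≤ t → 0 < lam t := fun t ht => (hlam_range t ht).1
  have hr : ∀ t : ℝ, 0 ≤ t → 0 < eps t / lam t := fun t ht => div_pos (heps_pos t ht) (hlp t ht)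
  have hex : ∀ t : ℝ, ∃ z : H, 0 ≤ t → T z - z = (eps t / lam t) • (z - y) := by
    intro t
    by_cases ht : 0 ≤ t
    · obtain ⟨z, hz⟩ := aux_exists T hT y (hr t ht)
      exact ⟨z, fun _ => hz⟩
    · exact ⟨0, fun h => absurd h ht⟩
  choose z hz using hex
  have hzm : ∀ s t, 0 ≤ s → s ≤ t → ‖z t - z s‖ ^ 2 ≤ ‖z t - y‖ ^ 2 - ‖z s - y‖ ^ 2 :=
    fun s t hs hst => aux_mono T hT y (hr t (hs.trans hst)).le (hr s hs) (hmono s t hs hst)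
      (hz t (hs.trans hst)) (hz s hs)
  have hzb : ∀ q, T q = q → ∀ t, 0 ≤ t → ‖z t - y‖ ≤ ‖q - y‖ := by
    intro q hq t ht
    have h := aux_mono T hT y le_rfl (hr t ht) (hr t ht).le (a := q) (by rw [hq]; simp) (hz t ht)
    have h2 : ‖z t - y‖ ^ 2 ≤ ‖q - y‖ ^ 2 := by nlinarith [sq_nonneg ‖q - z t‖]
    exact (sq_le_sq₀ (norm_nonneg _) (norm_nonneg _)).1 h2
  -- convergence of the approximating curve
  have hcauchy : CauchySeq z := by
    rw [Metric.cauchySeq_iff']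
    intro ε hε
    set A : Set ℝ := (fun t => ‖z t - y‖ ^ 2) '' Ici 0
    have hA : A.Nonempty := ⟨_, mem_image_of_mem _ (mem_Ici.2 le_rfl)⟩
    have hAb : BddAbove A := by
      refine ⟨‖p0 - y‖ ^ 2, ?_⟩
      rintro _ ⟨t, ht, rfl⟩
      exact pow_le_pow_left₀ (norm_nonneg _) (hzb p0 hp0 t ht) 2
    obtain ⟨_, ⟨N, hN, rfl⟩, hlt⟩ := exists_lt_of_lt_csSup hA
      (show sSup A - ε ^ 2 < sSup A by nlinarith)
    have hN' : (0:ℝ) ≤ N := hN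
    refine ⟨N, fun n hn => ?_⟩
    have h1 := hzm N n hN' hn
    have h2 : ‖z n - y‖ ^ 2 ≤ sSup A :=
      le_csSup hAb (mem_image_of_mem (fun t => ‖z t - y‖ ^ 2) (mem_Ici.2 (hN'.trans hn)))
    rw [dist_eq_norm]
    have h3 : ‖z n - z N‖ ^ 2 < ε ^ 2 := by
      simp only at hlt
      linarith
    exact lt_of_pow_lt_pow_left₀ 2 hε.le h3
  obtain ⟨p, hp⟩ := cauchySeq_tendsto_of_complete hcauchy
  have hTc : Continuous T := by
    refine (LipschitzWith.of_dist_le_mul (K := 1) fun a b => ?_).continuous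
    rw [dist_eq_norm, dist_eq_norm]
    simpa using hT a b
  have hTp : T p = p := by
    have h1 : Tendsto (fun t => T (z t) - z t) atTop (𝓝 (T p - p)) :=
      ((hTc.tendsto p).comp hp).sub hp
    have h2 : Tendsto (fun t => T (z t) - z t) atTop (𝓝 ((0:ℝ) • (p - y))) := by
      refine (hratio.smul (hp.sub_const y)).congr' ?_
      filter_upwards [eventually_ge_atTop (0:ℝ)] with t ht
      exact (hz t ht).symm
    have h3 := tendsto_nhds_unique h1 h2
    rw [zero_smul, sub_eq_zero] at h3
    exact h3
  refine ⟨p, hTp, ?_, ?_⟩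
  · intro q hq
    refine le_of_tendsto (hp.sub_const y).norm ?_
    filter_upwards [eventually_ge_atTop (0:ℝ)] with t ht
    exact hzb q hq t ht
  -- regularity
  have hec := aux_cont hepsd_int hepsAC
  have hlc := aux_cont hlamd_int hlamAC
  have hfc : ContinuousOn (fun s => lam s • (T (x s) - x s) - eps s • (x s - y)) (Ici 0) :=
    (hlc.smul ((hTc.comp_continuousOn hxc).sub hxc)).sub
      (hec.smul (hxc.sub continuousOn_const))
  have hxd : ∀ t, 0 < t → HasDerivAt x (lam t • (T (x t) - x t) - eps t • (x t - y)) t := by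
    intro t ht
    refine ((aux_hasDeriv _ hfc ht).const_add x₀).congr_of_eventuallyEq ?_
    filter_upwards [Ioi_mem_nhds ht] with w hw
    exact hxeq w (le_of_lt hw)
  set E : ℝ → ℝ := fun t => ∫ s in (0:ℝ)..t, eps s with hEdef
  have hEd : ∀ t, 0 < t → HasDerivAt E (eps t) t := fun t ht => aux_hasDeriv _ hec ht
  have hEtop : Tendsto E atTop atTop := aux_top eps heps_pos heps_int hi
  set M : ℝ := ‖p0 - y‖ + 1 with hM
  have hMpos : 0 < M := by positivity
  have hdiff : Tendsto (fun t => ‖x t - z t‖) atTop (𝓝 0) := by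
    rw [Metric.tendsto_nhds]
    intro δ hδ
    set η : ℝ := δ / (4 * M) with hη
    have hηpos : 0 < η := by positivity
    have hMη : M * η = δ / 4 := by rw [hη]; field_simp
    have hev : ∀ᶠ t in atTop, |epsd t / (eps t) ^ 2 - lamd t / (lam t * eps t)| < η := by
      have := (Metric.tendsto_nhds.1 hiv) η hηpos
      simpa [Real.dist_eq] using this
    obtain ⟨S0, hS0⟩ := eventually_atTop.1 hev
    set S : ℝ := max S0 1
    have hS1 : 1 ≤ S := le_max_right _ _
    have hSpos : 0 < S := by linarith
    have hq : ∀ t, S ≤ t → |epsd t / (eps t) ^ 2 - lamd t / (lam t * eps t)| ≤ η :=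
      fun t ht => (hS0 t ((le_max_left _ _).trans ht)).le
    have hzz : ∀ s t, S ≤ s → s ≤ t → ‖z t - z s‖ ≤ δ / 4 * (E t - E s) := by
      intro s t hs hst
      have hs0 : 0 ≤ s := hSpos.le.trans hs
      have ht0 : 0 ≤ t := hs0.trans hst
      have h1 := aux_lip T hT y (hr t ht0) (hmono s t hs0 hst) (hz t ht0) (hz s hs0)
      have h2 := aux_logratio lam eps epsd lamd hlp heps_pos hepsd_int hepsAC hlamd_int hlamAC
        heps_int hSpos.le hq hs hst
      have h3 : ∫ w in s..t, eps w = E t - E s :=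
        (intervalIntegral.integral_interval_sub_left (heps_int t) (heps_int s)).symm
      rw [h3] at h2
      have h4 : ‖z t - y‖ ≤ M := by linarith [hzb p0 hp0 t ht0]
      calc _ ≤ _ := h1
        _ ≤ M * (η * (E t - E s)) := mul_le_mul h4 h2 (abs_nonneg _) hMpos.le
        _ = _ := by rw [← mul_assoc, hMη]
    have hEc : ContinuousOn E (Ici S) := fun t ht =>
      (hEd t (hSpos.trans_le ht)).continuousAt.continuousWithinAt
    have hzabs : ∀ s t, S ≤ s → S ≤ t → ‖z t - z s‖ ≤ δ / 4 * |E t - E s| := by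
      intro s t hs ht
      rcases le_total s t with h | h
      · exact (hzz s t hs h).trans (by gcongr; exact le_abs_self _)
      · rw [norm_sub_rev, abs_sub_comm]
        exact (hzz t s ht h).trans (by gcongr; exact le_abs_self _)
    have hzc : ContinuousOn z (Ici S) := by
      intro s hs
      have h0 : Tendsto (fun t => δ / 4 * |E t - E s|) (𝓝[Ici S] s) (𝓝 0) := by
        have := (((hEc s hs).sub_const (E s)).abs).const_mul (δ / 4)
        simpa using this
      rw [ContinuousWithinAt, tendsto_iff_norm_sub_tendsto_zero]
      refine squeeze_zero' (Eventually.of_forall fun t => norm_nonneg _) ?_ h0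
      filter_upwards [self_mem_nhdsWithin] with t ht
      exact hzabs s t hs ht
    have huc : ContinuousOn (fun t => ‖x t - z t‖) (Ici S) :=
      ((hxc.mono (Ici_subset_Ici.2 hSpos.le)).sub hzc).norm
    have hfence := aux_fence eps (fun t => ‖x t - z t‖) E S (δ / 4) (by positivity)
      (fun t ht => hEd t (hSpos.trans_le ht)) (fun t ht => heps_pos t (hSpos.le.trans ht)) huc
      (fun t ht => aux_slope T hT y x z E (lam t) (eps t) (δ / 4) t
        (hlp t (hSpos.le.trans ht)) (heps_pos t (hSpos.le.trans ht)) (by positivity)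
        (hxd t (hSpos.trans_le ht)) (hEd t (hSpos.trans_le ht)) (hz t (hSpos.le.trans ht))
        (fun w hw => hzz t w ht hw))
    have hexp : Tendsto (fun t => ‖x S - z S‖ * Real.exp (-(E t - E S))) atTop (𝓝 0) := by
      have h1 : Tendsto (fun t => E t - E S) atTop atTop :=
        tendsto_atTop_add_const_right atTop (-E S) hEtop
      have := (Real.tendsto_exp_neg_atTop_nhds_zero.comp h1).const_mul ‖x S - z S‖
      simpa using this
    filter_upwards [eventually_ge_atTop S, hexp.eventually (Iio_mem_nhds (half_pos hδ))]
      with t ht h2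
    have h3 := hfence t ht
    have h2' : ‖x S - z S‖ * Real.exp (-(E t - E S)) < δ / 2 := h2
    rw [Real.dist_eq, sub_zero, abs_of_nonneg (norm_nonneg _)]
    linarith
  have h1 : Tendsto (fun t => x t - z t) atTop (𝓝 0) := tendsto_zero_iff_norm_tendsto_zero.2 hdiff
  have h2 := h1.add hp
  simpa using h2
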